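/- Let T be any set of propositional axioms whose condensed-detachment theorems coincide with those of the Łukasiewicz system L1, L2, L3 (i.e., T is an axiomatization of two-valued propositional logic). Suppose there exist double-negation-free condensed-detachment proofs of L1, L2, and L3 from T. Then T admits strong double-negation elimination. -/

import Mathlib

/-- Propositional formulas built from countably many variables by implication `i`
and negation `n`. -/
inductive Fm : Type
  | var : ℕ → Fm
  | i : Fm → Fm → Fm
  | n : Fm → Fm
  deriving DecidableEq

namespace Fm

/-- Homomorphic extension of a substitution (of formulas for variables). -/
def subst (σ : ℕ → Fm) : Fm → Fm
  | var k => σ k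
  | i a b => i (subst σ a) (subst σ b)
  | n a => n (subst σ a)

/-- The (finite) set of variables occurring in a formula. -/
def vars : Fm → Finset ℕ
  | var k => {k}
  | i a b => vars a ∪ vars b
  | n a => vars a

/-- `Sub s t` : `s` is a (not necessarily proper) subformula of `t`. -/
inductive Sub : Fm → Fm → Prop
  | refl (t : Fm) : Sub t t
  | il {s a b : Fm} : Sub s a → Sub s (i a b)
  | ir {s a b : Fm} : Sub s b → Sub s (i a b)
  | neg {s a : Fm} : Sub s a → Sub s (n a)

end Fm

/-- The renaming substitution induced by a permutation of the variables. -/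
def renameSubst (p : Equiv.Perm ℕ) : ℕ → Fm := fun k => Fm.var (p k)

/-- `AlphVar A B` : `B` is an alphabetic variant of `A`
(obtained from `A` by an injective renaming of variables). -/
def AlphVar (A B : Fm) : Prop := ∃ p : Equiv.Perm ℕ, B = A.subst (renameSubst p)

/-- `σ` unifies `A` and `C`. -/
def Unifies (σ : ℕ → Fm) (A C : Fm) : Prop := A.subst σ = C.subst σ

/-- `σ` is a most general unifier of `A` and `C`. -/
def IsMGU (σ : ℕ → Fm) (A C : Fm) : Prop :=
  Unifies σ A C ∧ ∀ τ : ℕ → Fm, Unifies τ A C → ∃ ρ : ℕ → Fm, ∀ k, τ k = (σ k).subst ρ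

/-- Condensed detachment: from the major premiss `maj = i(A,B)` and minor premiss
`minor` (renamed to `C`, sharing no variables with the major premiss), if `σ` is a
most general unifier of `A` and `C`, conclude `Bσ` (up to renaming of variables). -/
def CD (maj minor concl : Fm) : Prop :=
  ∃ (A B C : Fm) (σ : ℕ → Fm),
    maj = Fm.i A B ∧ AlphVar minor C ∧ Disjoint (Fm.i A B).vars C.vars ∧
    IsMGU σ A C ∧ AlphVar (B.subst σ) concl

/-- A formula contains a double negation if it has a subformula of the form `n(n(t))`. -/
def ContainsDN (A : Fm) : Prop := ∃ t : Fm, Fm.Sub (Fm.n (Fm.n t)) A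

/-- Existence of a condensed-detachment proof from axiom set `L` in which every
*deduced* (non-axiom) step satisfies the predicate `allowed`.  A step is an
alphabetic variant of an axiom of `L` or follows from two earlier steps by
condensed detachment. -/
inductive CDProof (L : Set Fm) (allowed : Fm → Prop) : Fm → Prop
  | ax {a b : Fm} : a ∈ L → AlphVar a b → CDProof L allowed b
  | cd {p q c : Fm} : CDProof L allowed p → CDProof L allowed q → CD p q c → allowed c →
      CDProof L allowed c

/-- `B` is provable from `L` by condensed detachment. -/
def CDProvable (L : Set Fm) (B : Fm) : Prop := CDProof L (fun _ => True) B

/-- A formula is double-negation free. -/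
def DNFree (f : Fm) : Prop := ¬ ContainsDN f

/-- `B` has a double-negation-free condensed-detachment proof from `L`
(no deduced step contains a double negation). -/
def DNFreeCDProvable (L : Set Fm) (B : Fm) : Prop := CDProof L DNFree B

/-- Every doubly negated subformula of `f` is (an alphabetic variant of) a doubly
negated subformula of `B`. -/
def DNOk (B : Fm) : Fm → Prop := fun f =>
  ∀ t : Fm, Fm.Sub (Fm.n (Fm.n t)) f → ∃ s : Fm, Fm.Sub (Fm.n (Fm.n s)) B ∧ AlphVar s t

/-- Existence of a proof from axioms `L` and (variable-free) assumptions `Δ` using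
modus ponens and substitution, in which every deduced step satisfies `allowed`. -/
inductive HProof (L Δ : Set Fm) (allowed : Fm → Prop) : Fm → Prop
  | ax {a : Fm} : a ∈ L → HProof L Δ allowed a
  | hyp {a : Fm} : a ∈ Δ → HProof L Δ allowed a
  | mp {a b : Fm} : HProof L Δ allowed (Fm.i a b) → HProof L Δ allowed a → allowed b →
      HProof L Δ allowed b
  | subst {a : Fm} (σ : ℕ → Fm) : HProof L Δ allowed a → allowed (a.subst σ) →
      HProof L Δ allowed (a.subst σ)

/-- Existence of a proof by modus ponens only from the set `S` of premisses, in which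
every deduced step satisfies `allowed`. -/
inductive MPProof (S : Set Fm) (allowed : Fm → Prop) : Fm → Prop
  | prem {a : Fm} : a ∈ S → MPProof S allowed a
  | mp {a b : Fm} : MPProof S allowed (Fm.i a b) → MPProof S allowed a → allowed b →
      MPProof S allowed b

/-- The set of substitution instances of members of `L`. -/
def SubstInstances (L : Set Fm) : Set Fm := {b | ∃ a ∈ L, ∃ σ : ℕ → Fm, b = a.subst σ}

/-- A formula containing no variables. -/
def VarFree (A : Fm) : Prop := A.vars = ∅

/-- Replace all occurrences of the selected doubly negated subformulas `n(n(q))`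
(`q ∈ S`) by `q`. -/
def eraseDN (S : Finset Fm) : Fm → Fm
  | .var k => .var k
  | .i a b => .i (eraseDN S a) (eraseDN S b)
  | .n (.var k) => .n (.var k)
  | .n (.i a b) => .n (.i (eraseDN S a) (eraseDN S b))
  | .n (.n q) => if q ∈ S then eraseDN S q else .n (eraseDN S (.n q))

/-- `L` admits strong double-negation elimination: whenever `B` is provable from `L`
by condensed detachment and `B*` is obtained from `B` by erasing all occurrences of
a chosen set of doubly negated subformulas of `B`, then `B*` has a condensed-detachment
proof from `L` whose deduced steps contain no doubly negated subformulas other than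
(alphabetic variants of) those occurring in `B*`. -/
def StrongDNE (L : Set Fm) : Prop :=
  ∀ (B : Fm) (S : Finset Fm), CDProvable L B → (∀ q ∈ S, Fm.Sub (.n (.n q)) B) →
    CDProof L (DNOk (eraseDN S B)) (eraseDN S B)

/-- Replace every occurrence of the variable `v` by `n(v)` and cancel the resulting
double negations. -/
def flipNeg (v : ℕ) : Fm → Fm
  | .var k => if k = v then .n (.var v) else .var k
  | .i a b => .i (flipNeg v a) (flipNeg v b)
  | .n a => if a = .var v then .var v else .n (flipNeg v a)

/-- Membership in `L*`: the closure of `L` under the operation of replacing a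
negated variable `x` (i.e. one with `n(x)` occurring) everywhere by `n(x)`,
cancelling resulting double negations. -/
inductive StarMem (L : Set Fm) : Fm → Prop
  | base {a : Fm} : a ∈ L → StarMem L a
  | step {a : Fm} {v : ℕ} : StarMem L a → Fm.Sub (.n (.var v)) a → StarMem L (flipNeg v a)

/-- D1 = i(x,x) -/
def D1 : Fm := .i (.var 0) (.var 0)
/-- D2 = i(i(x,x),i(n(x),n(x))) -/
def D2 : Fm := .i (.i (.var 0) (.var 0)) (.i (.n (.var 0)) (.n (.var 0)))
/-- D3 = i(i(x,x),i(i(y,y),i(i(x,y),i(x,y)))) -/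
def D3 : Fm := .i (.i (.var 0) (.var 0))
  (.i (.i (.var 1) (.var 1)) (.i (.i (.var 0) (.var 1)) (.i (.var 0) (.var 1))))

/-- L1 = i(i(x,y),i(i(y,z),i(x,z))) -/
def L1 : Fm := .i (.i (.var 0) (.var 1)) (.i (.i (.var 1) (.var 2)) (.i (.var 0) (.var 2)))
/-- L2 = i(i(n(x),x),x) -/
def L2 : Fm := .i (.i (.n (.var 0)) (.var 0)) (.var 0)
/-- L3 = i(x,i(n(x),y)) -/
def L3 : Fm := .i (.var 0) (.i (.n (.var 0)) (.var 1))
/-- L4 = i(i(x,n(x)),n(x)) -/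
def L4 : Fm := .i (.i (.var 0) (.n (.var 0))) (.n (.var 0))
/-- L5 = i(n(x),i(x,y)) -/
def L5 : Fm := .i (.n (.var 0)) (.i (.var 0) (.var 1))
/-- The Łukasiewicz axiom system for two-valued propositional calculus. -/
def Lax : Set Fm := {L1, L2, L3}

/-- A1 = i(x,i(y,x)) -/
def A1 : Fm := .i (.var 0) (.i (.var 1) (.var 0))
/-- A2 = i(i(x,y),i(i(y,z),i(x,z))) -/
def A2 : Fm := .i (.i (.var 0) (.var 1)) (.i (.i (.var 1) (.var 2)) (.i (.var 0) (.var 2)))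
/-- A3 = i(i(i(x,y),y),i(i(y,x),x)) -/
def A3 : Fm := .i (.i (.i (.var 0) (.var 1)) (.var 1)) (.i (.i (.var 1) (.var 0)) (.var 0))
/-- A4 = i(i(n(x),n(y)),i(y,x)) -/
def A4 : Fm := .i (.i (.n (.var 0)) (.n (.var 1))) (.i (.var 1) (.var 0))
/-- A6 = i(i(x,y),i(n(y),n(x))) -/
def A6 : Fm := .i (.i (.var 0) (.var 1)) (.i (.n (.var 1)) (.n (.var 0)))
/-- A7 = i(i(n(x),y),i(n(y),x)) -/
def A7 : Fm := .i (.i (.n (.var 0)) (.var 1)) (.i (.n (.var 1)) (.var 0))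
/-- A8 = i(i(x,n(y)),i(y,n(x))) -/
def A8 : Fm := .i (.i (.var 0) (.n (.var 1))) (.i (.var 1) (.n (.var 0)))
/-- The axiom system of Łukasiewicz's infinite-valued sentential calculus. -/
def Aax : Set Fm := {A1, A2, A3, A4}

/-- H1 = i(x,i(y,x)) -/
def H1 : Fm := .i (.var 0) (.i (.var 1) (.var 0))
/-- H2 = i(i(x,i(y,z)),i(i(x,y),i(x,z))) -/
def H2 : Fm := .i (.i (.var 0) (.i (.var 1) (.var 2)))
  (.i (.i (.var 0) (.var 1)) (.i (.var 0) (.var 2)))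
/-- H3 = i(i(x,n(x)),n(x)) -/
def H3 : Fm := .i (.i (.var 0) (.n (.var 0))) (.n (.var 0))
/-- H4 = i(x,i(n(x),y)) -/
def H4 : Fm := .i (.var 0) (.i (.n (.var 0)) (.var 1))
/-- The intuitionistic axiom system H. -/
def Hax : Set Fm := {H1, H2, H3, H4}

/-! ### Substitution, renaming and double negations -/

namespace Fm

theorem subst_subst (σ τ : ℕ → Fm) (t : Fm) :
    (t.subst σ).subst τ = t.subst (fun k => (σ k).subst τ) := by
  induction t <;> simp_all [subst]

theorem subst_eq_subst_iff {σ τ : ℕ → Fm} {t : Fm} :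
    t.subst σ = t.subst τ ↔ ∀ k ∈ t.vars, σ k = τ k := by
  induction t with
  | var k => simp [subst, vars]
  | i a b iha ihb =>
    simp only [subst, vars, i.injEq, Finset.mem_union, iha, ihb]
    grind
  | n a iha => simpa [subst, vars] using iha

theorem subst_var (t : Fm) : t.subst var = t := by
  induction t <;> simp_all [subst]

theorem mem_vars_subst {σ : ℕ → Fm} {t : Fm} {k : ℕ} :
    k ∈ (t.subst σ).vars ↔ ∃ j ∈ t.vars, k ∈ (σ j).vars := by
  induction t with
  | var j => simp [subst, vars]
  | i a b iha ihb =>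
    simp only [subst, vars, Finset.mem_union, iha, ihb]
    grind
  | n a iha => simpa [subst, vars] using iha

theorem mem_vars_rename {p : Equiv.Perm ℕ} {t : Fm} {k : ℕ} :
    k ∈ (t.subst (renameSubst p)).vars ↔ p.symm k ∈ t.vars := by
  rw [mem_vars_subst]
  constructor
  · rintro ⟨j, hj, hk⟩
    simp only [renameSubst, vars, Finset.mem_singleton] at hk
    simpa [hk] using hj
  · intro h
    exact ⟨_, h, by simp [renameSubst, vars]⟩

theorem sub_var {s : Fm} {k : ℕ} : Sub s (var k) ↔ s = var k :=
  ⟨fun h => by cases h; rfl, fun h => h ▸ Sub.refl _⟩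

theorem sub_i {s a b : Fm} : Sub s (i a b) ↔ s = i a b ∨ Sub s a ∨ Sub s b := by
  constructor
  · intro h
    cases h with
    | refl => exact .inl rfl
    | il h => exact .inr (.inl h)
    | ir h => exact .inr (.inr h)
  · rintro (rfl | h | h)
    exacts [.refl _, .il h, .ir h]

theorem sub_n {s a : Fm} : Sub s (n a) ↔ s = n a ∨ Sub s a := by
  constructor
  · intro h
    cases h with
    | refl => exact .inl rfl
    | neg h => exact .inr h
  · rintro (rfl | h)
    exacts [.refl _, .neg h]

theorem sub_nn_rename {p : Equiv.Perm ℕ} {f t : Fm}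
    (h : Sub (n (n t)) (f.subst (renameSubst p))) :
    ∃ s, Sub (n (n s)) f ∧ t = s.subst (renameSubst p) := by
  induction f with
  | var k => simp [subst, renameSubst, sub_var] at h
  | i a b iha ihb =>
    simp only [subst, sub_i, reduceCtorEq, false_or] at h
    rcases h with h | h
    · obtain ⟨s, hs, e⟩ := iha h
      exact ⟨s, .il hs, e⟩
    · obtain ⟨s, hs, e⟩ := ihb h
      exact ⟨s, .ir hs, e⟩
  | n a iha =>
    simp only [subst, sub_n, n.injEq] at h
    rcases h with h | h
    · cases a with
      | var k => simp [subst, renameSubst] at h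
      | i a b => simp [subst] at h
      | n a =>
        simp only [subst, n.injEq] at h
        exact ⟨a, .refl _, h⟩
    · obtain ⟨s, hs, e⟩ := iha (by simpa [sub_n] using h)
      exact ⟨s, .neg hs, e⟩

/-- Every doubly negated subformula of `f` is a subformula of `A`. -/
def DNIn (A f : Fm) : Prop := ∀ t, Sub (n (n t)) f → Sub (n (n t)) A

section DNIn

variable {A : Fm}

theorem DNIn.self : DNIn A A := fun _ h => h

@[simp] theorem dnIn_var {k : ℕ} : DNIn A (var k) := by simp [DNIn, sub_var]

@[simp] theorem dnIn_i {a b : Fm} : DNIn A (i a b) ↔ DNIn A a ∧ DNIn A b := by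
  simp [DNIn, sub_i, or_imp, forall_and]

@[simp] theorem dnIn_n_var {k : ℕ} : DNIn A (n (var k)) := by simp [DNIn, sub_var, sub_n]

@[simp] theorem dnIn_n_i {a b : Fm} : DNIn A (n (i a b)) ↔ DNIn A a ∧ DNIn A b := by
  simp [DNIn, sub_i, sub_n, or_imp, forall_and]

theorem DNIn.of_n {a : Fm} (h : DNIn A (n a)) : DNIn A a := fun t ht => h t (.neg ht)

theorem DNIn.dnOk {f : Fm} (h : DNIn A f) : DNOk A f := fun t ht =>
  ⟨t, h t ht, 1, (subst_var t).symm⟩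

end DNIn

/-- Truth value of a formula. -/
def eval (v : ℕ → Bool) : Fm → Bool
  | var k => v k
  | i a b => !eval v a || eval v b
  | n a => !eval v a

theorem eval_subst (v : ℕ → Bool) (σ : ℕ → Fm) (t : Fm) :
    (t.subst σ).eval v = t.eval (fun k => (σ k).eval v) := by
  induction t <;> simp_all [subst, eval]

theorem eval_eraseDN (v : ℕ → Bool) (S : Finset Fm) (t : Fm) :
    (eraseDN S t).eval v = t.eval v := by
  fun_induction eraseDN S t <;> simp_all [eval]

/-- A two-valued tautology. -/
def Taut (t : Fm) : Prop := ∀ v, t.eval v = true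

end Fm

theorem AlphVar.symm {a b : Fm} : AlphVar a b → AlphVar b a := by
  rintro ⟨p, rfl⟩
  refine ⟨p.symm, ?_⟩
  rw [Fm.subst_subst]
  simpa [renameSubst, Fm.subst] using (Fm.subst_var a).symm

theorem AlphVar.refl (a : Fm) : AlphVar a a :=
  ⟨1, (Fm.subst_var a).symm⟩

theorem AlphVar.trans {a b c : Fm} : AlphVar a b → AlphVar b c → AlphVar a c := by
  rintro ⟨p, rfl⟩ ⟨q, rfl⟩
  exact ⟨p.trans q, by rw [Fm.subst_subst]; rfl⟩

theorem DNOk.alphVar {A f g : Fm} (hf : DNOk A f) (h : AlphVar f g) : DNOk A g := by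
  obtain ⟨p, rfl⟩ := h
  intro t ht
  obtain ⟨s, hs, rfl⟩ := Fm.sub_nn_rename ht
  obtain ⟨r, hr, hrs⟩ := hf s hs
  exact ⟨r, hr, hrs.trans ⟨p, rfl⟩⟩

theorem DNFree.dnOk {A f : Fm} (hf : DNFree f) : DNOk A f := fun t ht => (hf ⟨t, ht⟩).elim

namespace CDProof

variable {L : Set Fm} {ok ok' : Fm → Prop} {f g : Fm}

theorem mono (h : ∀ f, ok f → ok' f) (hf : CDProof L ok f) : CDProof L ok' f := by
  induction hf with
  | ax ha hab => exact .ax ha hab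
  | cd _ _ hc hok ih₁ ih₂ => exact .cd ih₁ ih₂ hc (h _ hok)

theorem alphVar (hok : ∀ f g, ok f → AlphVar f g → ok g) (hf : CDProof L ok f)
    (h : AlphVar f g) : CDProof L ok g := by
  cases hf with
  | ax ha hab => exact .ax ha (hab.trans h)
  | cd h₁ h₂ hc hf =>
    obtain ⟨A, B, C, σ, e, hC, hd, hσ, hB⟩ := hc
    exact .cd h₁ h₂ ⟨A, B, C, σ, e, hC, hd, hσ, hB.trans h⟩ (hok _ _ hf h)

/-- Replace axioms by derivations. -/
theorem bind {L' : Set Fm} (hok : ∀ f g, ok f → AlphVar f g → ok g)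
    (hL : ∀ a ∈ L, CDProof L' ok a) (hf : CDProof L ok f) : CDProof L' ok f := by
  induction hf with
  | ax ha hab => exact (hL _ ha).alphVar hok hab
  | cd _ _ hc h ih₁ ih₂ => exact .cd ih₁ ih₂ hc h

end CDProof

/-! ### Soundness -/

theorem Fm.Taut.alphVar {a b : Fm} (ha : a.Taut) : AlphVar a b → b.Taut := by
  rintro ⟨p, rfl⟩ v
  rw [Fm.eval_subst]
  exact ha _

theorem taut_of_cdProvable_lax {B : Fm} (h : CDProvable Lax B) : B.Taut := by
  induction h with
  | @ax a b ha hab =>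
    refine Fm.Taut.alphVar (fun v => ?_) hab
    rcases ha with rfl | rfl | rfl <;> simp only [L1, L2, L3, Fm.eval] <;> grind
  | cd _ _ hc _ ih₁ ih₂ =>
    obtain ⟨A, B, C, σ, rfl, hC, -, hσ, hB⟩ := hc
    refine Fm.Taut.alphVar (fun v => ?_) hB
    have hA : (A.subst σ).eval v = true := by
      rw [show A.subst σ = C.subst σ from hσ.1, Fm.eval_subst]
      exact ih₂.alphVar hC _
    have := ih₁ (fun k => (σ k).eval v)
    rw [Fm.eval_subst] at hA ⊢
    simpa [Fm.eval, hA] using this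

/-! ### Condensed detachment by matching -/

/-- The involution exchanging `[0, N)` and `[N, 2 * N)`. -/
def blockSwap (N : ℕ) : Equiv.Perm ℕ where
  toFun k := if k < N then k + N else if k < 2 * N then k - N else k
  invFun k := if k < N then k + N else if k < 2 * N then k - N else k
  left_inv k := by dsimp only; split_ifs <;> omega
  right_inv k := by dsimp only; split_ifs <;> omega

theorem exists_perm_forall_notMem (s u : Finset ℕ) {m : ℕ} (y : ℕ) (hm : m ∉ s) :
    ∃ p : Equiv.Perm ℕ, p m = y ∧ ∀ k ∈ s, p k ∉ u := by
  obtain ⟨N, hN⟩ : ∃ N, ∀ k ∈ insert m (insert y (s ∪ u)), k < N :=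
    ⟨_, fun k hk => Nat.lt_succ_of_le (Finset.le_sup (f := id) hk)⟩
  simp only [Finset.mem_insert, Finset.mem_union] at hN
  have hq : ∀ k < N, blockSwap N k = k + N := fun k hk => by simp [blockSwap, hk]
  refine ⟨(blockSwap N).trans (Equiv.swap (blockSwap N m) y), by simp, fun k hk hu => ?_⟩
  have hkN := hN k (by simp [hk])
  have hmN := hN m (by simp)
  have hyN := hN y (by simp)
  have hkm : k ≠ m := fun e => hm (e ▸ hk)
  have := hN _ (.inr (.inr (.inr hu)))
  rw [Equiv.trans_apply, hq k hkN, hq m hmN,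
    Equiv.swap_apply_of_ne_of_ne (by omega) (by omega)] at this
  omega

namespace CD

theorem of_subst_right (B M : Fm) (σ : ℕ → Fm) : CD (.i (M.subst σ) B) M B := by
  obtain ⟨m, hm⟩ := Infinite.exists_notMem_finset M.vars
  obtain ⟨p, -, hp⟩ := exists_perm_forall_notMem M.vars (Fm.i (M.subst σ) B).vars 0 hm
  let C := M.subst (renameSubst p)
  have hC : ∀ k ∈ (Fm.i (M.subst σ) B).vars, k ∉ C.vars := fun k hk hkC =>
    hp _ (Fm.mem_vars_rename.1 hkC) (by simpa using hk)
  let θ : ℕ → Fm := fun k => if k ∈ C.vars then σ (p.symm k) else .var k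
  have hθ : ∀ t : Fm, (∀ k ∈ t.vars, k ∉ C.vars) → t.subst θ = t := fun t ht => by
    conv_rhs => rw [← Fm.subst_var t]
    exact Fm.subst_eq_subst_iff.2 fun k hk => if_neg (ht k hk)
  have h₁ : (M.subst σ).subst θ = M.subst σ :=
    hθ _ fun k hk => hC k (Finset.mem_union_left _ hk)
  have h₂ : B.subst θ = B := hθ _ fun k hk => hC k (Finset.mem_union_right _ hk)
  refine ⟨M.subst σ, B, C, θ, rfl, ⟨p, rfl⟩, Finset.disjoint_left.2 hC, ⟨?_, ?_⟩, ?_⟩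
  · rw [Unifies, h₁, Fm.subst_subst, Fm.subst_eq_subst_iff]
    intro k hk
    have : p k ∈ C.vars := Fm.mem_vars_rename.2 (by simpa using hk)
    simp [renameSubst, Fm.subst, θ, this]
  · intro τ hτ
    refine ⟨τ, fun k => ?_⟩
    by_cases hk : k ∈ C.vars
    · rw [Unifies, Fm.subst_subst, Fm.subst_subst, Fm.subst_eq_subst_iff] at hτ
      have := hτ _ (Fm.mem_vars_rename.1 hk)
      simpa [θ, hk, renameSubst, Fm.subst] using this.symm
    · simp [θ, hk, Fm.subst]
  · rw [h₂]
    exact .refl B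

theorem of_subst_left_of_fresh {A B : Fm} {σ : ℕ → Fm} {y m : ℕ}
    (hB : B.vars ⊆ insert y A.vars) (hy : y ∉ A.vars) (hσ : σ y = .var m)
    (hm : m ∉ (A.subst σ).vars) : CD (.i A B) (A.subst σ) (B.subst σ) := by
  obtain ⟨p, hpm, hp⟩ := exists_perm_forall_notMem (A.subst σ).vars (Fm.i A B).vars y hm
  let C := (A.subst σ).subst (renameSubst p)
  have hC : ∀ k ∈ (Fm.i A B).vars, k ∉ C.vars := fun k hk hkC =>
    hp _ (Fm.mem_vars_rename.1 hkC) (by simpa using hk)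
  let θ : ℕ → Fm := fun k => if k ∈ A.vars then (σ k).subst (renameSubst p) else .var k
  have h₁ : A.subst θ = C := by
    simp only [C]
    rw [Fm.subst_subst, Fm.subst_eq_subst_iff]
    exact fun k hk => if_pos hk
  refine ⟨A, B, C, θ, rfl, ⟨p, rfl⟩, Finset.disjoint_left.2 hC, ⟨?_, ?_⟩, AlphVar.symm ⟨p, ?_⟩⟩
  · rw [Unifies, h₁]
    conv_lhs => rw [← Fm.subst_var C]
    rw [Fm.subst_eq_subst_iff]
    intro k hk
    exact (if_neg fun hkA => hC k (Finset.mem_union_left _ hkA) hk).symm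
  · intro τ hτ
    refine ⟨τ, fun k => ?_⟩
    by_cases hk : k ∈ A.vars
    · have hCτ : C.subst τ = A.subst fun k => (θ k).subst τ := by rw [← h₁, Fm.subst_subst]
      rw [Unifies, hCτ, Fm.subst_eq_subst_iff] at hτ
      exact hτ k hk
    · simp [θ, hk, Fm.subst]
  · rw [Fm.subst_subst, Fm.subst_eq_subst_iff]
    intro k hk
    by_cases hkA : k ∈ A.vars
    · simp [θ, hkA]
    · obtain rfl : k = y := by simpa [hkA] using hB hk
      simp [θ, hkA, hσ, Fm.subst, renameSubst, hpm]

theorem of_subst_left {A B : Fm} (hB : B.vars ⊆ A.vars) (σ : ℕ → Fm) :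
    CD (.i A B) (A.subst σ) (B.subst σ) := by
  obtain ⟨y, hy⟩ := Infinite.exists_notMem_finset A.vars
  obtain ⟨m, hm⟩ := Infinite.exists_notMem_finset (A.subst σ).vars
  have h : ∀ t : Fm, t.vars ⊆ A.vars → t.subst (Function.update σ y (.var m)) = t.subst σ :=
    fun t ht => Fm.subst_eq_subst_iff.2 fun k hk =>
      Function.update_of_ne (fun e => hy (by simpa [e] using ht hk)) _ _
  have := of_subst_left_of_fresh (σ := Function.update σ y (.var m)) (m := m)
    (hB.trans (Finset.subset_insert y _)) hy (by simp) (by rwa [h A subset_rfl])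
  rwa [h A subset_rfl, h B hB] at this

theorem modus_ponens (A B : Fm) : CD (.i A B) A B := by
  simpa [Fm.subst_var] using of_subst_right B A .var

end CD

/-! ### A verified checker for condensed detachment -/

namespace Fm

/-- Unification without occurs check and with bounded recursion depth. The second argument lists
the equations still to be solved, the third accumulates the solution. -/
def unify : ℕ → List (Fm × Fm) → (ℕ → Fm) → Option (ℕ → Fm)
  | 0, _, _ => none
  | _ + 1, [], σ => some σ
  | N + 1, (s, t) :: E, σ =>
    let solve (a : ℕ) (t : Fm) :=
      let θ : ℕ → Fm := fun k => if k = a then t else var k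
      unify N (E.map fun e => (e.1.subst θ, e.2.subst θ)) (fun k => (σ k).subst θ)
    match s, t with
    | i a b, i c d => unify N ((a, c) :: (b, d) :: E) σ
    | n a, n b => unify N ((a, b) :: E) σ
    | var a, t => if t = var a then unify N E σ else solve a t
    | s, var b => solve b s
    | _, _ => none

theorem unify_sound {N : ℕ} {E : List (Fm × Fm)} {σ σ' τ : ℕ → Fm}
    (h : unify N E σ = some σ') (hE : ∀ e ∈ E, e.1.subst τ = e.2.subst τ)
    (hσ : ∀ k, τ k = (σ k).subst τ) (k : ℕ) : τ k = (σ' k).subst τ := by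
  induction N generalizing E σ with
  | zero => simp [unify] at h
  | succ N ih =>
    match E with
    | [] =>
      simp only [unify, Option.some.injEq] at h
      exact h ▸ hσ k
    | (s, t) :: E =>
      have hst : s.subst τ = t.subst τ := hE (s, t) (by simp)
      have hE₂ : ∀ e ∈ E, e.1.subst τ = e.2.subst τ := fun e he => hE e (by simp [he])
      have solve : ∀ (a : ℕ) (t : Fm), τ a = t.subst τ →
          unify N (E.map fun e => (e.1.subst fun k => if k = a then t else var k,
            e.2.subst fun k => if k = a then t else var k))
            (fun k => (σ k).subst fun k => if k = a then t else var k) = some σ' →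
          τ k = (σ' k).subst τ := by
        intro a t hat h
        have hθ : ∀ u : Fm, (u.subst fun k => if k = a then t else var k).subst τ =
            u.subst τ := fun u => by
          rw [subst_subst, subst_eq_subst_iff]
          intro j _
          split_ifs with hj
          · rw [hj, hat]
          · rfl
        refine ih h ?_ fun k => (hσ k).trans (hθ _).symm
        intro e he
        obtain ⟨e', he', rfl⟩ := List.mem_map.1 he
        simpa only [hθ] using hE₂ e' he'
      cases s with
      | var a =>
        simp only [unify] at h
        split_ifs at h
        · exact ih h hE₂ hσ
        · exact solve a t hst h
      | i a b =>
        cases t with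
        | var b => exact solve _ _ hst.symm h
        | n b => simp [unify] at h
        | i c d =>
          simp only [subst, i.injEq] at hst
          refine ih h ?_ hσ
          simpa [hst] using hE₂
      | n a =>
        cases t with
        | var b => exact solve _ _ hst.symm h
        | i b c => simp [unify] at h
        | n b =>
          simp only [subst, n.injEq] at hst
          refine ih h ?_ hσ
          simpa [hst] using hE₂

/-- The first variable of a formula whose index is at least `j`. -/
def firstVarGE (j : ℕ) : Fm → Option ℕ
  | var k => if j ≤ k then some k else none
  | i a b => (firstVarGE j a).or (firstVarGE j b)
  | n a => firstVarGE j a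

/-- The permutation exchanging `a` and `b`. -/
def swapPerm (a b : ℕ) : Equiv.Perm ℕ where
  toFun k := if k = a then b else if k = b then a else k
  invFun k := if k = a then b else if k = b then a else k
  left_inv k := by dsimp only; split_ifs <;> omega
  right_inv k := by dsimp only; split_ifs <;> omega

/-- Renumber at most `N` variables in order of occurrence, from `j` on. -/
def normalize : (N j : ℕ) → Fm → Fm
  | 0, _, f => f
  | N + 1, j, f =>
    match firstVarGE j f with
    | none => f
    | some v => normalize N (j + 1) (f.subst (renameSubst (swapPerm v j)))

theorem alphVar_normalize (N j : ℕ) (f : Fm) : AlphVar f (normalize N j f) := by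
  induction N generalizing j f with
  | zero => exact .refl f
  | succ N ih =>
    simp only [normalize]
    split
    · exact .refl f
    · exact AlphVar.trans ⟨_, rfl⟩ (ih _ _)

/-- Check that no subformula is a double negation. -/
def dnFree : Fm → Bool
  | var _ => true
  | i a b => dnFree a && dnFree b
  | n (var _) => true
  | n (i a b) => dnFree a && dnFree b
  | n (n _) => false

theorem dnFree_of_eq_true {f : Fm} (h : f.dnFree = true) : DNFree f := by
  rintro ⟨t, ht⟩
  fun_induction dnFree f <;> simp_all [sub_var, sub_i, sub_n]

/-- Compute the result of condensed detachment, for formulas with few variables and provided that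
it is free of double negations. -/
def condensedDetach (p q : Fm) : Option Fm :=
  match p with
  | i A B =>
    let C := q.subst (renameSubst (blockSwap 16))
    match unify 64 [(A, C)] var with
    | none => none
    | some σ =>
      let c := normalize 16 0 (B.subst σ)
      if Disjoint (i A B).vars C.vars ∧ A.subst σ = C.subst σ ∧ c.dnFree = true then some c
      else none
  | _ => none

theorem condensedDetach_sound {p q c : Fm} (h : condensedDetach p q = some c) :
    CD p q c ∧ DNFree c := by
  match p with
  | var _ => simp [condensedDetach] at h
  | n _ => simp [condensedDetach] at h
  | i A B =>
    simp only [condensedDetach] at h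
    split at h
    · simp at h
    · rename_i σ hσ
      split_ifs at h with hc
      obtain rfl := Option.some.inj h
      refine ⟨⟨A, B, _, σ, rfl, ⟨_, rfl⟩, hc.1, ⟨hc.2.1, fun τ hτ => ⟨τ, ?_⟩⟩,
        alphVar_normalize _ _ _⟩, dnFree_of_eq_true hc.2.2⟩
      exact unify_sound hσ (by simpa [Unifies] using hτ) (fun k => by simp [subst])

/-- Extend a list of formulas by condensed detachments of the formulas at the given positions. -/
def runCD : List (ℕ × ℕ) → List Fm → List Fm
  | [], l => l
  | (a, b) :: s, l =>
    match l[a]?, l[b]? with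
    | some p, some q =>
      match condensedDetach p q with
      | some c => runCD s (l ++ [c])
      | none => l
    | _, _ => l

theorem runCD_sound {L : Set Fm} {s : List (ℕ × ℕ)} {l : List Fm}
    (hl : ∀ f ∈ l, CDProof L DNFree f) : ∀ f ∈ runCD s l, CDProof L DNFree f := by
  induction s generalizing l with
  | nil => simpa [runCD] using hl
  | cons e s ih =>
    simp only [runCD]
    split
    · rename_i p q hp hq
      split
      · rename_i c hc
        obtain ⟨hcd, hdn⟩ := condensedDetach_sound hc
        refine ih fun f hf => ?_
        rcases List.mem_append.1 hf with hf | hf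
        · exact hl f hf
        · obtain rfl := List.mem_singleton.1 hf
          exact .cd (hl _ (List.mem_of_getElem? hp)) (hl _ (List.mem_of_getElem? hq)) hcd hdn
      · exact hl
    · exact hl

end Fm

/-! ### Double-negation-free derivations from the Łukasiewicz axioms -/

/-- Positions of the major and minor premisses of a derivation from `L1`, `L2`, `L3`. -/
def laxDerivation : List (ℕ × ℕ) :=
  [(0, 2), (0, 0), (4, 4), (4, 0), (5, 6), (3, 6), (8, 1), (9, 1), (3, 10), (7, 11), (0,
   12), (13, 1), (3, 14), (0, 15), (16, 3), (0, 5), (0, 17), (19, 14), (0, 20), (21, 4),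
   (21, 3), (14, 23), (4, 24), (22, 25), (18, 26), (3, 1), (25, 22), (27, 17), (22, 30),
   (22, 31), (22, 27), (22, 33), (22, 22), (22, 35), (22, 36), (37, 22), (34, 38), (33, 39),
   (27, 40), (41, 22), (32, 42), (34, 22), (36, 44), (33, 45), (27, 46), (5, 20), (22, 48),
   (22, 49), (50, 22), (47, 51), (32, 52), (0, 23), (0, 54), (55, 14), (14, 17), (56, 57),
   (22, 58), (22, 2), (59, 60), (22, 61), (22, 62), (33, 35), (25, 64), (63, 65), (36, 35),
   (33, 67), (27, 68), (22, 69), (48, 68), (22, 71), (22, 0), (22, 73), (74, 65), (72, 75),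
   (70, 76)]

open Fm in
/-- The formulas obtained by `laxDerivation` that are used below. -/
def laxTheorems : List Fm :=
  [i (var 0) (i (var 1) (var 0)),
   i (i (var 0) (i (var 1) (var 2))) (i (i (var 0) (var 1)) (i (var 0) (var 2))),
   i (var 0) (var 0),
   i (i (var 0) (var 0)) (i (var 0) (var 0)),
   i (i (var 0) (i (var 1) (var 1))) (i (i (var 2) (var 0)) (i (var 2) (var 2))),
   i (i (var 0) (i (var 1) (var 1))) (i (i (var 2) (var 0)) (i (var 1) (var 1))),
   i (i (var 0) (i (var 1) (var 1))) (i (var 0) (i (n (var 1)) (n (var 1)))),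
   i (i (var 0) (i (var 1) (var 1))) (i (i (var 0) (i (var 2) (var 2)))
    (i (var 0) (i (i (var 1) (var 2)) (i (var 1) (var 2)))))]

theorem laxTheorems_subset :
    ∀ f ∈ laxTheorems, f ∈ Fm.runCD laxDerivation [L1, L2, L3] := by
  decide +kernel

theorem cdProof_of_mem_laxTheorems {f : Fm} (hf : f ∈ laxTheorems) : CDProof Lax DNFree f := by
  refine Fm.runCD_sound (fun g hg => .ax ?_ (.refl g)) f (laxTheorems_subset f hf)
  simpa [Lax] using hg

/-! ### Substitution instances of derived formulas -/

namespace Fm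

/-- A double-negation-free theorem containing exactly the variables up to `k`. -/
def context : ℕ → Fm
  | 0 => i (var 0) (var 0)
  | k + 1 => i (var (k + 1)) (context k)

theorem mem_vars_context {k j : ℕ} : j ∈ (context k).vars ↔ j ≤ k := by
  induction k with
  | zero => simp [context, vars]
  | succ k ih =>
    simp only [context, vars, Finset.mem_union, Finset.mem_singleton, ih]
    omega

@[simp] theorem dnIn_context {A : Fm} (k : ℕ) : DNIn A (context k) := by
  induction k <;> simp_all [context]

/-- The substitution sending the first three variables to `a`, `b`, `c`. -/
def subst₃ (a b c : Fm) : ℕ → Fm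
  | 0 => a
  | 1 => b
  | _ => c

end Fm

open Fm

section Instances

variable {A : Fm}

theorem CDProof.of_laxTheorems {f : Fm} (hf : f ∈ laxTheorems) : CDProof Lax (DNOk A) f :=
  (cdProof_of_mem_laxTheorems hf).mono fun _ => DNFree.dnOk

theorem cdProof_context (k : ℕ) : CDProof Lax (DNOk A) (context k) := by
  induction k with
  | zero => exact .of_laxTheorems (by decide)
  | succ k ih =>
    have hK : CDProof Lax (DNOk A) (i (var 0) (i (var 1) (var 0))) := .of_laxTheorems (by decide)
    refine .cd hK ih (CD.of_subst_left_of_fresh (y := 1) (m := k + 1)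
      (σ := subst₃ (context k) (var (k + 1)) (var 0)) (by decide) (by decide) rfl ?_)
      (DNIn.dnOk (A := A) (f := context (k + 1)) (by simp))
    simp [subst, subst₃, mem_vars_context]

theorem cdProof_context_imp_self_var {k j : ℕ} (hj : j ≤ k) :
    CDProof Lax (DNOk A) (i (context k) (i (var j) (var j))) := by
  induction k generalizing j with
  | zero =>
    obtain rfl := Nat.le_zero.1 hj
    exact .of_laxTheorems (by decide)
  | succ k ih =>
    have hok : ∀ l, DNOk A (i (context (k + 1)) (i (var l) (var l))) := fun l =>
      DNIn.dnOk (by simp)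
    have hm : ∀ l ≤ k, k + 1 ∉ (i (context k) (i (var l) (var l))).vars := fun l hl => by
      simp only [vars, Finset.mem_union, mem_vars_context, Finset.mem_singleton]
      omega
    rcases hj.lt_or_eq with hj | rfl
    · have hj := Nat.le_of_lt_succ hj
      have h : CDProof Lax (DNOk A) (i (i (var 0) (i (var 1) (var 1)))
        (i (i (var 2) (var 0)) (i (var 1) (var 1)))) := .of_laxTheorems (by decide)
      exact .cd h (ih hj) (CD.of_subst_left_of_fresh (y := 2) (m := k + 1)
        (σ := subst₃ (context k) (var j) (var (k + 1))) (by decide) (by decide) rfl (hm j hj))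
        (hok j)
    · have h : CDProof Lax (DNOk A) (i (i (var 0) (i (var 1) (var 1)))
        (i (i (var 2) (var 0)) (i (var 2) (var 2)))) := .of_laxTheorems (by decide)
      exact .cd h (ih (Nat.zero_le k)) (CD.of_subst_left_of_fresh (y := 2) (m := k + 1)
        (σ := subst₃ (context k) (var 0) (var (k + 1))) (by decide) (by decide) rfl
        (hm 0 (Nat.zero_le k))) (hok (k + 1))

theorem cdProof_context_imp_self {k : ℕ} {φ : Fm} (hv : ∀ j ∈ φ.vars, j ≤ k) (hφ : DNIn A φ) :
    CDProof Lax (DNOk A) (i (context k) (i φ φ)) := by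
  induction φ with
  | var j => exact cdProof_context_imp_self_var (hv j (by simp [vars]))
  | n φ ih =>
    have h : CDProof Lax (DNOk A) (i (i (var 0) (i (var 1) (var 1)))
      (i (var 0) (i (n (var 1)) (n (var 1))))) := .of_laxTheorems (by decide)
    exact .cd h (ih hv hφ.of_n) (CD.of_subst_left (by decide) (subst₃ (context k) φ φ))
      (DNIn.dnOk (A := A) (f := i (context k) (i (n φ) (n φ))) (by simp [hφ]))
  | i φ ψ ihφ ihψ =>
    simp only [vars, Finset.mem_union, or_imp, forall_and] at hv
    rw [dnIn_i] at hφ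
    have h : CDProof Lax (DNOk A) (i (i (var 0) (i (var 1) (var 1)))
      (i (i (var 0) (i (var 2) (var 2))) (i (var 0) (i (i (var 1) (var 2)) (i (var 1) (var 2)))))) :=
      .of_laxTheorems (by decide)
    have hm : ∀ χ : Fm, (∀ j ∈ χ.vars, j ≤ k) → k + 1 ∉ χ.vars := fun χ hχ hk => by
      have := hχ _ hk
      omega
    have h₁ : CDProof Lax (DNOk A) (i (i (context k) (i (var (k + 1)) (var (k + 1))))
        (i (context k) (i (i φ (var (k + 1))) (i φ (var (k + 1)))))) := by
      refine .cd h (ihφ hv.1 hφ.1) (CD.of_subst_left_of_fresh (y := 2) (m := k + 1)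
        (σ := subst₃ (context k) φ (var (k + 1))) (by decide) (by decide) rfl ?_)
        (DNIn.dnOk (by simp [hφ]))
      simp [subst, subst₃, vars, mem_vars_context, hm φ hv.1]
    have hσ : ∀ χ : Fm, (∀ j ∈ χ.vars, j ≤ k) →
        χ.subst (Function.update var (k + 1) ψ) = χ := fun χ hχ => by
      conv_rhs => rw [← subst_var χ]
      exact subst_eq_subst_iff.2 fun j hj =>
        Function.update_of_ne (fun e => hm χ hχ (by simpa [e] using hj)) _ _
    have hc := hσ (context k) fun j => mem_vars_context.1
    have hcd := CD.of_subst_left (A := i (context k) (i (var (k + 1)) (var (k + 1))))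
      (B := i (context k) (i (i φ (var (k + 1))) (i φ (var (k + 1))))) ?_
      (Function.update var (k + 1) ψ)
    · simp only [subst, hc, hσ φ hv.1, Function.update_self] at hcd
      exact .cd h₁ (ihψ hv.2 hφ.2) hcd (DNIn.dnOk (by simp [hφ]))
    · intro j hj
      have := hv.1 j
      simp only [vars, Finset.mem_union, mem_vars_context, Finset.mem_singleton] at hj ⊢
      tauto

theorem cdProof_imp_self {φ : Fm} (hφ : DNIn A φ) : CDProof Lax (DNOk A) (i φ φ) :=
  .cd (cdProof_context_imp_self (k := φ.vars.sup id)
      (fun _ hj => Finset.le_sup (f := id) hj) hφ)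
    (cdProof_context _) (CD.modus_ponens _ _) (DNIn.dnOk (by simp [hφ]))

theorem CDProof.subst_of_dnIn {M : Fm} (hM : CDProof Lax (DNOk A) M) {σ : ℕ → Fm}
    (h : DNIn A (M.subst σ)) : CDProof Lax (DNOk A) (M.subst σ) :=
  .cd (cdProof_imp_self h) hM (CD.of_subst_right _ _ _) h.dnOk

end Instances

/-! ### Completeness without new double negations -/

/-- Derivability from the theorems `Th` and the assumptions `Γ` by modus ponens. -/
inductive Entails (Th Γ : Fm → Prop) : Fm → Prop
  | thm {a : Fm} : Th a → Entails Th Γ a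
  | hyp {a : Fm} : Γ a → Entails Th Γ a
  | mp {a b : Fm} : Entails Th Γ (i a b) → Entails Th Γ a → Entails Th Γ b

/-- The formulas all of whose double negations occur in `A` and that are derivable from the
Łukasiewicz axioms in the sense required by strong double-negation elimination. -/
def LaxThm (A f : Fm) : Prop := DNIn A f ∧ CDProof Lax (DNOk A) f

section Completeness

variable {A a b c : Fm} {Γ Δ : Fm → Prop}

theorem laxThm_K (ha : DNIn A a) (hb : DNIn A b) : LaxThm A (i a (i b a)) := by
  have h : CDProof Lax (DNOk A) (i (var 0) (i (var 1) (var 0))) := .of_laxTheorems (by decide)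
  have h' : DNIn A (i a (i b a)) := by simp [ha, hb]
  exact ⟨h', h.subst_of_dnIn (σ := subst₃ a b b) h'⟩

theorem laxThm_S (ha : DNIn A a) (hb : DNIn A b) (hc : DNIn A c) :
    LaxThm A (i (i a (i b c)) (i (i a b) (i a c))) := by
  have h : CDProof Lax (DNOk A) (i (i (var 0) (i (var 1) (var 2)))
    (i (i (var 0) (var 1)) (i (var 0) (var 2)))) := .of_laxTheorems (by decide)
  have h' : DNIn A (i (i a (i b c)) (i (i a b) (i a c))) := by simp [ha, hb, hc]
  exact ⟨h', h.subst_of_dnIn (σ := subst₃ a b c) h'⟩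

theorem laxThm_imp_self (ha : DNIn A a) : LaxThm A (i a a) :=
  ⟨by simp [ha], cdProof_imp_self ha⟩

theorem laxThm_L2 (ha : DNIn A (n a)) : LaxThm A (i (i (n a) a) a) := by
  have h : CDProof Lax (DNOk A) L2 := .ax (by simp [Lax]) (.refl _)
  have h' : DNIn A (i (i (n a) a) a) := by simp [ha, ha.of_n]
  exact ⟨h', h.subst_of_dnIn (σ := subst₃ a a a) h'⟩

theorem laxThm_L3 (ha : DNIn A (n a)) (hb : DNIn A b) : LaxThm A (i a (i (n a) b)) := by
  have h : CDProof Lax (DNOk A) L3 := .ax (by simp [Lax]) (.refl _)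
  have h' : DNIn A (i a (i (n a) b)) := by simp [ha, ha.of_n, hb]
  exact ⟨h', h.subst_of_dnIn (σ := subst₃ a b b) h'⟩

namespace Entails

theorem mono (h : Entails (LaxThm A) Γ a) (hΓ : ∀ f, Γ f → Δ f) : Entails (LaxThm A) Δ a := by
  induction h with
  | thm h => exact .thm h
  | hyp h => exact .hyp (hΓ _ h)
  | mp _ _ ih₁ ih₂ => exact .mp ih₁ ih₂

theorem dnIn (h : Entails (LaxThm A) Γ a) (hΓ : ∀ f, Γ f → DNIn A f) : DNIn A a := by
  induction h with
  | thm h => exact h.1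
  | hyp h => exact hΓ _ h
  | mp _ _ ih₁ _ => exact (dnIn_i.1 ih₁).2

theorem laxThm (h : Entails (LaxThm A) (fun _ => False) a) : LaxThm A a := by
  induction h with
  | thm h => exact h
  | hyp h => exact h.elim
  | mp _ _ ih₁ ih₂ =>
    have h := (dnIn_i.1 ih₁.1).2
    exact ⟨h, .cd ih₁.2 ih₂.2 (CD.modus_ponens _ _) h.dnOk⟩

/-- Deduction theorem. -/
theorem imp_intro (hΓ : ∀ f, Γ f → DNIn A f) (ha : DNIn A a)
    (h : Entails (LaxThm A) (fun f => f = a ∨ Γ f) b) : Entails (LaxThm A) Γ (i a b) := by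
  have hΓ' : ∀ f, f = a ∨ Γ f → DNIn A f := fun f hf => hf.elim (fun e => e ▸ ha) (hΓ f)
  induction h with
  | thm h => exact .mp (.thm (laxThm_K h.1 ha)) (.thm h)
  | @hyp b h =>
    rcases h with rfl | h
    · exact .thm (laxThm_imp_self ha)
    · exact .mp (.thm (laxThm_K (hΓ _ h) ha)) (.hyp h)
  | mp h₁ h₂ ih₁ ih₂ =>
    have hbc := dnIn_i.1 (h₁.dnIn hΓ')
    exact .mp (.mp (.thm (laxThm_S ha hbc.1 hbc.2)) ih₁) ih₂

theorem absurd (h₁ : Entails (LaxThm A) Γ a) (h₂ : Entails (LaxThm A) Γ (n a))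
    (hΓ : ∀ f, Γ f → DNIn A f) (hb : DNIn A b) : Entails (LaxThm A) Γ b :=
  .mp (.mp (.thm (laxThm_L3 (h₂.dnIn hΓ) hb)) h₁) h₂

/-- Weakening by a new first hypothesis. -/
theorem weaken (h : Entails (LaxThm A) Γ b) : Entails (LaxThm A) (fun f => f = a ∨ Γ f) b :=
  h.mono fun _ => .inr

theorem assume : Entails (LaxThm A) (fun f => f = a ∨ Γ f) a := .hyp (.inl rfl)

theorem dnIn_cons (hΓ : ∀ f, Γ f → DNIn A f) (ha : DNIn A a) :
    ∀ f, f = a ∨ Γ f → DNIn A f := fun f hf => hf.elim (fun e => e ▸ ha) (hΓ f)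

/-- Consequentia mirabilis. -/
theorem by_contra (hΓ : ∀ f, Γ f → DNIn A f) (ha : DNIn A (n a))
    (h : Entails (LaxThm A) (fun f => f = n a ∨ Γ f) a) : Entails (LaxThm A) Γ a :=
  .mp (.thm (laxThm_L2 ha)) (h.imp_intro hΓ ha)

/-- If `a` entails `n a`, then `n a`. Applying consequentia mirabilis to `n a` would introduce a
double negation; it is applied to `i (i a (n a)) (n a)` and to `a` instead. -/
theorem neg_intro (hΓ : ∀ f, Γ f → DNIn A f) (ha : DNIn A (n a))
    (h : Entails (LaxThm A) (fun f => f = a ∨ Γ f) (n a)) : Entails (LaxThm A) Γ (n a) := by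
  have ha' := ha.of_n
  have hc : DNIn A (n (i (i a (n a)) (n a))) := by simp [ha, ha']
  refine .mp (by_contra hΓ hc ?_) (h.imp_intro hΓ ha')
  have hΓ₁ := dnIn_cons hΓ hc
  have hx : Entails (LaxThm A) (fun f => f = n (i (i a (n a)) (n a)) ∨ Γ f) a := by
    refine by_contra hΓ₁ ha (absurd (imp_intro (dnIn_cons hΓ₁ ha) ?_ (weaken assume))
      (weaken assume) (dnIn_cons hΓ₁ ha) ha')
    simp [ha, ha']
  refine imp_intro hΓ₁ (by simp [ha, ha']) (.mp assume (weaken hx))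

end Entails

/-- The complement of a formula: cancel a leading negation, or else add one. -/
def Fm.compl : Fm → Fm
  | n a => a
  | a => n a

theorem Fm.DNIn.compl (ha : DNIn A a) : DNIn A a.compl := by
  cases a with
  | var k => simp [Fm.compl]
  | i a b => simpa [Fm.compl] using ha
  | n a => exact ha.of_n

theorem Entails.absurd_compl (h₁ : Entails (LaxThm A) Γ a) (h₂ : Entails (LaxThm A) Γ a.compl)
    (hΓ : ∀ f, Γ f → DNIn A f) (hb : DNIn A b) : Entails (LaxThm A) Γ b := by
  cases a with
  | n a => exact absurd h₂ h₁ hΓ hb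
  | _ => exact absurd h₁ h₂ hΓ hb

theorem Entails.by_cases_compl (hΓ : ∀ f, Γ f → DNIn A f) (ha : DNIn A a)
    (h : Entails (LaxThm A) (fun f => f = a.compl ∨ Γ f) a) : Entails (LaxThm A) Γ a := by
  cases a with
  | n a => exact neg_intro hΓ ha h
  | _ => exact by_contra hΓ ha.compl h

/-- `f` or its complement, whichever is true under `v`. -/
def Fm.literal (v : ℕ → Bool) (f : Fm) : Fm := if f.eval v then f else f.compl

/-- The literals of the first `k` variables that are true under `v`. -/
def literals (v : ℕ → Bool) (k : ℕ) : Fm → Prop := fun f => ∃ j < k, f = (var j).literal v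

theorem dnIn_literals {v : ℕ → Bool} {k : ℕ} : ∀ f, literals v k f → DNIn A f := by
  rintro f ⟨j, -, rfl⟩
  unfold literal
  split_ifs
  · simp
  · exact dnIn_var.compl

theorem entails_literal (v : ℕ → Bool) {k : ℕ} {f : Fm} (hv : ∀ j ∈ f.vars, j < k)
    (hf : DNIn A f) : Entails (LaxThm A) (literals v k) (f.literal v) := by
  have hΓ : ∀ f, literals v k f → DNIn A f := dnIn_literals
  induction f with
  | var j => exact .hyp ⟨j, hv j (by simp [vars]), rfl⟩
  | n a ih =>
    have ih := ih hv hf.of_n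
    by_cases ha : a.eval v = true
    · simpa [literal, eval, ha, Fm.compl] using ih
    · simp only [literal, eval, ha] at ih ⊢
      simp only [Bool.false_eq_true, if_false, Bool.not_false, if_true] at ih ⊢
      refine .neg_intro hΓ hf (Entails.absurd_compl .assume (.weaken ih)
        (Entails.dnIn_cons hΓ hf.of_n) hf)
  | i a b iha ihb =>
    simp only [vars, Finset.mem_union, or_imp, forall_and] at hv
    have hab := dnIn_i.1 hf
    have iha := iha hv.1 hab.1
    have ihb := ihb hv.2 hab.2
    by_cases hb : b.eval v = true
    · simp only [literal, eval, hb, Bool.or_true, if_true] at ihb ⊢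
      exact .imp_intro hΓ hab.1 (.weaken ihb)
    simp only [Bool.not_eq_true] at hb
    by_cases ha : a.eval v = true
    · simp only [literal, eval, ha, hb, Bool.not_true, Bool.or_false, if_true, if_false,
        Bool.false_eq_true] at iha ihb ⊢
      have hn : DNIn A (n (i a b)) := hf.compl
      refine .neg_intro hΓ hn (Entails.absurd_compl (a := b) (.mp .assume (.weaken iha))
        (.weaken ihb) (Entails.dnIn_cons hΓ hf) hn)
    · simp only [Bool.not_eq_true] at ha
      simp only [literal, eval, ha, Bool.not_false, Bool.true_or, if_true, if_false,
        Bool.false_eq_true] at iha ⊢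
      exact .imp_intro hΓ hab.1 (Entails.absurd_compl .assume (.weaken iha)
        (Entails.dnIn_cons hΓ hab.1) hab.2)

/-- A formula follows if it follows both from a variable and from its negation. -/
theorem Entails.of_var_cases {k : ℕ} (hΓ : ∀ f, Γ f → DNIn A f) (ha : DNIn A a)
    (h₁ : Entails (LaxThm A) (fun f => f = var k ∨ Γ f) a)
    (h₂ : Entails (LaxThm A) (fun f => f = n (var k) ∨ Γ f) a) : Entails (LaxThm A) Γ a := by
  have hn : DNIn A (n (var k)) := dnIn_n_var
  have h₁ := imp_intro hΓ dnIn_var h₁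
  have h₂ := imp_intro hΓ hn h₂
  refine by_cases_compl hΓ ha (.mp (.weaken h₂) ?_)
  have hΓ' := dnIn_cons hΓ ha.compl
  exact neg_intro hΓ' hn (absurd_compl (.mp (.weaken (.weaken h₁)) .assume) (.weaken .assume)
    (dnIn_cons hΓ' dnIn_var) hn)

theorem entails_literals_of_taut (hA : A.Taut) {k j : ℕ} (hk : ∀ l ∈ A.vars, l < k) (hj : j ≤ k)
    (v : ℕ → Bool) : Entails (LaxThm A) (literals v j) A := by
  induction hj using Nat.decreasingInduction generalizing v with
  | self => simpa [literal, hA v] using entails_literal v hk (DNIn.self (A := A))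
  | of_succ j _ ih =>
    have key : ∀ t : Bool, ∀ f, literals (Function.update v j t) (j + 1) f →
        f = (if t then var j else n (var j)) ∨ literals v j f := by
      rintro t f ⟨l, hl, rfl⟩
      rcases Nat.lt_succ_iff_lt_or_eq.1 hl with hl | rfl
      · refine .inr ⟨l, hl, ?_⟩
        have : Function.update v j t l = v l := Function.update_of_ne hl.ne _ _
        simp only [literal, eval, this]
        congr
      · exact .inl (by cases t <;> simp [literal, eval, Fm.compl])
    exact .of_var_cases dnIn_literals DNIn.self ((ih _).mono (key true)) ((ih _).mono (key false))

theorem cdProof_lax_of_taut (hA : A.Taut) : CDProof Lax (DNOk A) A := by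
  have h := entails_literals_of_taut hA (k := A.vars.sup id + 1)
    (fun _ hl => Nat.lt_succ_of_le (Finset.le_sup (f := id) hl)) (Nat.zero_le _) fun _ => true
  exact (h.mono fun f hf => by obtain ⟨j, hj, -⟩ := hf; omega).laxThm.2

end Completeness

/-- If `T` is any axiomatization of two-valued propositional logic (its
condensed-detachment theorems coincide with those of L1, L2, L3) and there exist
double-negation-free condensed-detachment proofs of L1, L2, L3 from `T`, then `T`
admits strong double-negation elimination. -/
theorem stmt11 (T : Set Fm)
    (hequiv : ∀ B : Fm, CDProvable T B ↔ CDProvable Lax B)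
    (hL : DNFreeCDProvable T L1 ∧ DNFreeCDProvable T L2 ∧ DNFreeCDProvable T L3) :
    StrongDNE T := by
  intro B S hB _
  have htaut : (eraseDN S B).Taut := fun v => by
    rw [Fm.eval_eraseDN]
    exact taut_of_cdProvable_lax ((hequiv B).1 hB) v
  refine (cdProof_lax_of_taut htaut).bind (fun _ _ => DNOk.alphVar) fun a ha => ?_
  have hok : ∀ f, DNFree f → DNOk (eraseDN S B) f := fun _ => DNFree.dnOk
  rcases ha with rfl | rfl | rfl
  exacts [hL.1.mono hok, hL.2.1.mono hok, hL.2.2.mono hok]
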